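/- arXiv:1905.12461 — 4 statements merged into one kernel-verified Lean document; each statement's English description precedes it below -/
import Mathlib

section
/- Let G be a finite simple graph that can be written as G = (G_k, A_k, B_k) ∘ ⋯ ∘ (G_1, A_1, B_1) ∘ G_0, where k ≥ 0, each (G_i, A_i, B_i) for i ∈ {1,…,k} is a splitted graph, and G_0 is a (possibly empty) finite simple graph. Then cw(G) ≤ max{4, max_{i ∈ {1,…,k}} scw(G_i, A_i, B_i), cw(G_0)}. -/
namespace CWPaper

/-! ## Clique-width expressions -/

/-- Syntax of clique-width expressions.  Labels are natural numbers (`0`-indexed, so a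
`k`-expression uses labels `0, …, k-1`). -/
inductive Expr : Type
  | vert : ℕ → Expr
  | union : Expr → Expr → Expr
  | join : ℕ → ℕ → Expr → Expr
  | relabel : ℕ → ℕ → Expr → Expr

namespace Expr

/-- The vertex set of an expression: one vertex per `vert` leaf. -/
def Verts : Expr → Type
  | vert _ => Unit
  | union a b => Verts a ⊕ Verts b
  | join _ _ a => Verts a
  | relabel _ _ a => Verts a

/-- The label of each vertex after evaluating the expression. -/
def label : (e : Expr) → e.Verts → ℕ
  | vert i, _ => i
  | union a b, v => Sum.elim a.label b.label v
  | join _ _ a, v => a.label v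
  | relabel i j a, v => if a.label v = i then j else a.label v

/-- The adjacency relation of the labeled graph built by the expression. -/
def adj : (e : Expr) → e.Verts → e.Verts → Prop
  | vert _, _, _ => False
  | union a b, u, v =>
      match u, v with
      | .inl u, .inl v => a.adj u v
      | .inr u, .inr v => b.adj u v
      | _, _ => False
  | join i j a, u, v =>
      a.adj u v ∨ (a.label u = i ∧ a.label v = j) ∨ (a.label u = j ∧ a.label v = i)
  | relabel _ _ a, u, v => a.adj u v

/-- `e` is a `k`-expression: all labels used are among `0, …, k-1`, and joins use two
distinct labels. -/
def Valid (k : ℕ) : Expr → Prop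
  | vert i => i < k
  | union a b => Valid k a ∧ Valid k b
  | join i j a => i < k ∧ j < k ∧ i ≠ j ∧ Valid k a
  | relabel i j a => i < k ∧ j < k ∧ Valid k a

/-- The expression `e` constructs the simple graph `G` (the final labels are ignored). -/
def Constructs (e : Expr) {V : Type*} (G : SimpleGraph V) : Prop :=
  ∃ f : e.Verts ≃ V, ∀ u v, G.Adj (f u) (f v) ↔ e.adj u v

/-- The expression `e` constructs the graph `G` *split labeled* with respect to `(A, B)`:
every vertex of `A` ends with the first label (encoded `0`) and every vertex of `B` ends
with the second label (encoded `1`). -/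
def ConstructsSplit (e : Expr) {V : Type*} (G : SimpleGraph V) (A B : Set V) : Prop :=
  ∃ f : e.Verts ≃ V, (∀ u v, G.Adj (f u) (f v) ↔ e.adj u v) ∧
    ∀ u, (f u ∈ A → e.label u = 0) ∧ (f u ∈ B → e.label u = 1)

end Expr

/-- The clique-width of a graph: the least `k` such that some `k`-expression constructs it. -/
noncomputable def cliqueWidth {V : Type*} (G : SimpleGraph V) : ℕ :=
  sInf {k | ∃ e : Expr, e.Valid k ∧ e.Constructs G}

/-- The split clique-width of a splitted graph `(G, A, B)`: the least `k` such that some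
`k`-expression constructs `G` split labeled. -/
noncomputable def splitCliqueWidth {V : Type*} (G : SimpleGraph V) (A B : Set V) : ℕ :=
  sInf {k | ∃ e : Expr, e.Valid k ∧ e.ConstructsSplit G A B}

/-! ## Splitted graphs and compositions -/

/-- `(G, A, B)` is a splitted graph: `A` and `B` partition the vertex set, `A` is a clique
and `B` is an independent set. -/
def IsSplitted {V : Type*} (G : SimpleGraph V) (A B : Set V) : Prop :=
  A ∪ B = Set.univ ∧ Disjoint A B ∧
    (∀ a ∈ A, ∀ b ∈ A, a ≠ b → G.Adj a b) ∧ (∀ a ∈ B, ∀ b ∈ B, ¬ G.Adj a b)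

/-- The composition `(G, A, B) ∘ H` of a splitted graph with a graph `H` on a disjoint
vertex set: take the disjoint union and add all edges between `A` and `V(H)`. -/
def comp {U W : Type*} (G : SimpleGraph U) (A : Set U) (H : SimpleGraph W) :
    SimpleGraph (U ⊕ W) :=
  SimpleGraph.fromRel fun x y =>
    match x, y with
    | .inl a, .inl b => G.Adj a b
    | .inr a, .inr b => H.Adj a b
    | .inl a, .inr _ => a ∈ A
    | .inr _, .inl _ => False

/-- Inverting a splitted graph `(G, A, B)`: remove all edges inside `A` and add all edges
inside `B`.  The inverse splitted graph is `(splitInverse G A B, B, A)`. -/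
def splitInverse {V : Type*} (G : SimpleGraph V) (A B : Set V) : SimpleGraph V :=
  SimpleGraph.fromRel fun x y =>
    (G.Adj x y ∧ ¬(x ∈ A ∧ y ∈ A)) ∨ (x ∈ B ∧ y ∈ B)

/-! ## Unigraphs -/

/-- The multiset of vertex degrees of a finite graph. -/
noncomputable def degreeMultiset (V : Type*) [Fintype V] (G : SimpleGraph V) : Multiset ℕ :=
  (Finset.univ.val : Multiset V).map fun v => (G.neighborSet v).ncard

/-- A finite graph is a unigraph if every finite graph with the same degree multiset is
isomorphic to it. -/
def IsUnigraph {V : Type u} [Fintype V] (G : SimpleGraph V) : Prop :=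
  ∀ (W : Type u) (_ : Fintype W) (H : SimpleGraph W),
    degreeMultiset W H = degreeMultiset V G → Nonempty (G ≃g H)

/-! ## Concrete graphs -/

/-- `mK2 m` : the disjoint union of `m` copies of `K₂`. -/
def mK2 (m : ℕ) : SimpleGraph (Fin m × Fin 2) :=
  SimpleGraph.fromRel fun x y => x.1 = y.1

/-- The star `K_{1,s}`; `none` is the center and the `some i` are the leaves. -/
def starG (s : ℕ) : SimpleGraph (Option (Fin s)) :=
  SimpleGraph.fromRel fun x _ => x = none

/-- `U2 m s` : the disjoint union of `mK₂` and the star `K_{1,s}`. -/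
def U2 (m s : ℕ) : SimpleGraph ((Fin m × Fin 2) ⊕ Option (Fin s)) :=
  SimpleGraph.fromRel fun x y =>
    match x, y with
    | .inl a, .inl b => a.1 = b.1
    | .inr a, .inr _ => a = none
    | _, _ => False

/-- `U3 m` : the disjoint union of `C₄` and `m` triangles with one vertex of each
component identified into the hub `none`.  The vertices `some (Sum.inl i)`, `i = 0, 1, 2`,
are the remaining path of the `C₄` (so the hub is joined to its two endpoints), and
`some (Sum.inr (i, x))` are the two remaining vertices of the `i`-th triangle. -/
def U3 (m : ℕ) : SimpleGraph (Option (Fin 3 ⊕ Fin m × Fin 2)) :=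
  SimpleGraph.fromRel fun x y =>
    match x, y with
    | none, some (.inl i) => i ≠ 1
    | none, some (.inr _) => True
    | some (.inl i), some (.inl j) => (i : ℕ) + 1 = (j : ℕ)
    | some (.inr a), some (.inr b) => a.1 = b.1
    | _, _ => False

/-- A graph is `P₄`-free if no four vertices induce a path on four vertices. -/
def P4Free {V : Type*} (G : SimpleGraph V) : Prop :=
  IsEmpty (SimpleGraph.pathGraph 4 ↪g G)

/-! ## The split unigraphs `S₂`, `S₃`, `S₄` -/

/-- Vertices of `S₂`: the centers `Sum.inl ⟨i, j⟩` (`j`-th center of multiplicity block `i`)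
and the leaves `Sum.inr ⟨i, j, x⟩` (`x`-th leaf of the star with center `⟨i, j⟩`). -/
def S2Verts (t : ℕ) (p q : Fin t → ℕ) : Type :=
  (Σ i : Fin t, Fin (q i)) ⊕ (Σ i : Fin t, Fin (q i) × Fin (p i))

/-- The center of the star a leaf belongs to. -/
def leafCenter {t : ℕ} {p q : Fin t → ℕ} (e : Σ i : Fin t, Fin (q i) × Fin (p i)) :
    Σ i : Fin t, Fin (q i) :=
  ⟨e.1, e.2.1⟩

/-- The split graph `S₂(p₁, q₁; …; p_t, q_t)`: for each `i`, take `q i` disjoint stars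
`K_{1, p i}` and join every two centers.  The clique is the set of centers
(`Set.range Sum.inl`) and the independent set is the set of leaves (`Set.range Sum.inr`). -/
def S2 (t : ℕ) (p q : Fin t → ℕ) : SimpleGraph (S2Verts t p q) :=
  SimpleGraph.fromRel fun x y =>
    match x, y with
    | .inl _, .inl _ => True
    | .inl c, .inr e => leafCenter e = c
    | _, _ => False

/-- The split graph `S₃(p, q₁; q₂)`: add to `S₂(p, q₁; p+1, q₂)` a new independent vertex
`none` joined to exactly the `q₁` centers of the stars `K_{1,p}`. -/
def S3 (p q1 q2 : ℕ) : SimpleGraph (Option (S2Verts 2 ![p, p + 1] ![q1, q2])) :=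
  SimpleGraph.fromRel fun x y =>
    match x, y with
    | some a, some b => (S2 2 ![p, p + 1] ![q1, q2]).Adj a b
    | none, some (.inl c) => c.1 = 0
    | _, _ => False

/-- The clique of the splitted graph `S₃(p, q₁; q₂)` (the star centers). -/
def S3A (p q1 q2 : ℕ) : Set (Option (S2Verts 2 ![p, p + 1] ![q1, q2])) :=
  {x | ∃ c, x = some (Sum.inl c)}

/-- The independent set of the splitted graph `S₃(p, q₁; q₂)` (the leaves and the extra
vertex `none`). -/
def S3B (p q1 q2 : ℕ) : Set (Option (S2Verts 2 ![p, p + 1] ![q1, q2])) :=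
  {x | x = none ∨ ∃ e, x = some (Sum.inr e)}

/-- The split graph `S₄(p, q)`: add to `S₃(p, 2; q)` a new clique vertex (the outer `none`)
joined to every vertex except itself and the special vertex `v` of `S₃` (here `some none`). -/
def S4 (p q : ℕ) : SimpleGraph (Option (Option (S2Verts 2 ![p, p + 1] ![2, q]))) :=
  SimpleGraph.fromRel fun x y =>
    match x, y with
    | some a, some b => (S3 p 2 q).Adj a b
    | none, some (some _) => True
    | _, _ => False

/-- The clique of the splitted graph `S₄(p, q)` (the star centers and the new vertex `u`). -/
def S4A (p q : ℕ) : Set (Option (Option (S2Verts 2 ![p, p + 1] ![2, q]))) :=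
  {x | x = none ∨ ∃ c, x = some (some (Sum.inl c))}

/-- The independent set of the splitted graph `S₄(p, q)` (the leaves and the vertex `v`). -/
def S4B (p q : ℕ) : Set (Option (Option (S2Verts 2 ![p, p + 1] ![2, q]))) :=
  {x | x = some none ∨ ∃ e, x = some (some (Sum.inr e))}

/-- Relative version of `Expr.Constructs`: some valid `K`-expression has vertex set `S`, realises
the relation `R` on `S` and gives every `v ∈ S` the final label `l v`. -/
def Builds {V : Type*} (K : ℕ) (R : V → V → Prop) (S : Set V) (l : V → ℕ) : Prop :=
  ∃ e : Expr, e.Valid K ∧ ∃ f : e.Verts ≃ S,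
    (∀ u v, R (f u) (f v) ↔ e.adj u v) ∧ ∀ u, e.label u = l (f u)

namespace Expr

theorem Valid.mono {m n : ℕ} (h : m ≤ n) : ∀ {e : Expr}, e.Valid m → e.Valid n
  | vert _, he => lt_of_lt_of_le he h
  | union _ _, he => ⟨he.1.mono h, he.2.mono h⟩
  | join _ _ _, he => ⟨he.1.trans_le h, he.2.1.trans_le h, he.2.2.1, he.2.2.2.mono h⟩
  | relabel _ _ _, he => ⟨he.1.trans_le h, he.2.1.trans_le h, he.2.2.mono h⟩

theorem Valid.label_lt {n : ℕ} : ∀ {e : Expr}, e.Valid n → ∀ v, e.label v < n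
  | vert _, he, _ => he
  | union _ _, he, .inl v => he.1.label_lt v
  | union _ _, he, .inr v => he.2.label_lt v
  | join _ _ _, he, v => he.2.2.2.label_lt v
  | relabel i j a, he, v => by
      have h := he.2.2.label_lt v
      change (if a.label v = i then j else a.label v) < n
      split_ifs
      exacts [he.2.1, h]

theorem nonempty_verts : ∀ e : Expr, Nonempty e.Verts
  | vert _ => ⟨()⟩
  | union a _ => a.nonempty_verts.map Sum.inl
  | join _ _ a => a.nonempty_verts
  | relabel _ _ a => a.nonempty_verts

end Expr

namespace Builds

variable {V : Type*} {K : ℕ} {R R' : V → V → Prop} {S T : Set V} {l l' : V → ℕ}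

theorem mono {m : ℕ} (h : Builds m R S l) (hm : m ≤ K) : Builds K R S l := by
  obtain ⟨e, he, hf⟩ := h
  exact ⟨e, he.mono hm, hf⟩

theorem congr (h : Builds K R S l) (hR : ∀ u ∈ S, ∀ v ∈ S, (R u v ↔ R' u v))
    (hl : ∀ v ∈ S, l v = l' v) : Builds K R' S l' := by
  obtain ⟨e, he, f, hadj, hlab⟩ := h
  refine ⟨e, he, f, fun u v => ?_, fun u => ?_⟩
  · rw [← hadj, hR _ (f u).2 _ (f v).2]
  · rw [hlab, hl _ (f u).2]

theorem label_lt (h : Builds K R S l) {v : V} (hv : v ∈ S) : l v < K := by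
  obtain ⟨e, he, f, -, hlab⟩ := h
  have := he.label_lt (f.symm ⟨v, hv⟩)
  simpa [hlab] using this

theorem singleton {v : V} (hR : ¬ R v v) (hv : l v < K) : Builds K R {v} l := by
  refine ⟨.vert (l v), hv, ⟨fun _ => ⟨v, rfl⟩, fun _ => (), fun _ => rfl, ?_⟩, ?_, fun _ => rfl⟩
  · rintro ⟨w, rfl⟩
    rfl
  · intro _ _
    exact iff_of_false hR id

theorem union (hS : Builds K R S l) (hT : Builds K R T l) (hd : Disjoint S T)
    (hR : ∀ u ∈ S, ∀ v ∈ T, ¬ R u v ∧ ¬ R v u) : Builds K R (S ∪ T) l := by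
  classical
  obtain ⟨a, ha, f, hfa, hfl⟩ := hS
  obtain ⟨b, hb, g, hgb, hgl⟩ := hT
  refine ⟨.union a b, ⟨ha, hb⟩,
    (Equiv.sumCongr f g).trans (Equiv.Set.union hd).symm, ?_, ?_⟩
  · rintro (u | u) (v | v)
    · simpa using! hfa u v
    · exact iff_of_false (hR _ (f u).2 _ (g v).2).1 id
    · exact iff_of_false (hR _ (f v).2 _ (g u).2).2 id
    · simpa using! hgb u v
  · rintro (u | u)
    · simpa using! hfl u
    · simpa using! hgl u

theorem join (h : Builds K R S l) {i j : ℕ} (hi : i < K) (hj : j < K) (hij : i ≠ j) :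
    Builds K (fun u v => R u v ∨ (l u = i ∧ l v = j) ∨ (l u = j ∧ l v = i)) S l := by
  obtain ⟨e, he, f, hadj, hlab⟩ := h
  refine ⟨.join i j e, ⟨hi, hj, hij, he⟩, f, fun (u v : e.Verts) => ?_, hlab⟩
  change (R (f u) (f v) ∨ (l (f u) = i ∧ l (f v) = j) ∨ (l (f u) = j ∧ l (f v) = i)) ↔
    e.adj u v ∨ (e.label u = i ∧ e.label v = j) ∨ (e.label u = j ∧ e.label v = i)
  rw [hlab, hlab, hadj]

theorem relabel (h : Builds K R S l) {i j : ℕ} (hi : i < K) (hj : j < K) :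
    Builds K R S (fun v => if l v = i then j else l v) := by
  obtain ⟨e, he, f, hadj, hlab⟩ := h
  refine ⟨.relabel i j e, ⟨hi, hj, he⟩, f, hadj, fun (u : e.Verts) => ?_⟩
  change (if e.label u = i then j else e.label u) = if l (f u) = i then j else l (f u)
  rw [hlab]

theorem relabel_finset (h : Builds K R S l) (φ : ℕ → ℕ) (L : Finset ℕ)
    (hL : ∀ x ∈ L, x < K ∧ φ x < K ∧ φ x ∉ L) :
    Builds K R S (fun v => if l v ∈ L then φ (l v) else l v) := by
  classical
  induction L using Finset.induction_on with
  | empty => simpa using h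
  | insert i L hi ih =>
    have hi' := hL i (Finset.mem_insert_self i L)
    refine ((ih fun x hx => ?_).relabel hi'.1 hi'.2.1).congr (fun _ _ _ _ => Iff.rfl) ?_
    · obtain ⟨h1, h2, h3⟩ := hL x (Finset.mem_insert_of_mem hx)
      exact ⟨h1, h2, fun h4 => h3 (Finset.mem_insert_of_mem h4)⟩
    · intro v _
      by_cases hv : l v ∈ L
      · have h3 := (hL _ (Finset.mem_insert_of_mem hv)).2.2
        rw [Finset.mem_insert, not_or] at h3
        simp [hv, h3.1]
      · by_cases hvi : l v = i <;> simp [hv, hvi, hi]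

theorem const_label (h : Builds K R S l) {c : ℕ} (hc : c < K) :
    Builds K R S (fun _ => c) := by
  refine (h.relabel_finset (fun _ => c) ((Finset.range K).erase c) ?_).congr
    (fun _ _ _ _ => Iff.rfl) ?_
  · intro x hx
    simp only [Finset.mem_erase, Finset.mem_range] at hx
    simp [hx.2, hc]
  · intro v hv
    have := h.label_lt hv
    by_cases hvc : l v = c <;> simp [hvc, this]

theorem edgeless (s : Finset V) (hs : s.Nonempty) (hl : ∀ v ∈ s, l v < K) :
    Builds K (fun _ _ => False) (s : Set V) l := by
  classical
  induction hs using Finset.Nonempty.cons_induction with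
  | singleton a =>
    simpa using singleton (R := fun _ _ => False) id (hl a (Finset.mem_singleton_self a))
  | cons a s ha hs ih =>
    rw [Finset.coe_cons, Set.insert_eq]
    refine union (singleton id (hl a (Finset.mem_cons_self a s)))
      (ih fun v hv => hl v (Finset.mem_cons_of_mem hv)) ?_ fun _ _ _ _ => ⟨id, id⟩
    simpa using ha

theorem add_edges (h : Builds K R S l) (hl : Set.InjOn l S) (E : Finset (V × V))
    (hE : ∀ p ∈ E, p.1 ∈ S ∧ p.2 ∈ S ∧ p.1 ≠ p.2) :
    Builds K (fun u v => R u v ∨ (u, v) ∈ E ∨ (v, u) ∈ E) S l := by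
  classical
  induction E using Finset.induction_on with
  | empty => simpa using h
  | insert p E hp ih =>
    obtain ⟨h1, h2, h3⟩ := hE p (Finset.mem_insert_self p E)
    refine ((ih fun q hq => hE q (Finset.mem_insert_of_mem hq)).join (h.label_lt h1)
      (h.label_lt h2) fun h4 => h3 (hl h1 h2 h4)).congr ?_ fun _ _ => rfl
    intro u hu v hv
    rw [hl.eq_iff hu h1, hl.eq_iff hu h2, hl.eq_iff hv h1, hl.eq_iff hv h2]
    simp only [Finset.mem_insert, Prod.ext_iff]
    tauto

theorem exists_of_injOn (G : SimpleGraph V) (s : Finset V) (hs : s.Nonempty)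
    (hl : Set.InjOn l (s : Set V)) (hK : ∀ v ∈ s, l v < K) :
    Builds K G.Adj (s : Set V) l := by
  classical
  refine ((edgeless s hs hK).add_edges hl ((s ×ˢ s).filter fun p => G.Adj p.1 p.2) ?_).congr
    ?_ fun _ _ => rfl
  · rintro ⟨u, v⟩ h
    simp only [Finset.mem_filter, Finset.mem_product] at h
    exact ⟨h.1.1, h.1.2, h.2.ne⟩
  · intro u hu v hv
    simp only [Finset.mem_coe] at hu hv
    simp [hu, hv, G.adj_comm v u]

/-- Every nonempty finite graph can be built with any prescribed labels `0` and `1`. -/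
theorem exists_labels_zero_one [Finite V] (G : SimpleGraph V) (hS : S.Nonempty) (t : V → ℕ)
    (ht : ∀ v, t v < 2) : ∃ K, Builds K G.Adj S t := by
  classical
  cases nonempty_fintype V
  set l : V → ℕ := fun v => Fintype.equivFin V v + 2 with hl_def
  have hl : Function.Injective l := fun u v h => by
    simpa [hl_def, Fin.val_inj] using h
  have hK : ∀ v, l v < Fintype.card V + 2 := fun v => by
    have := (Fintype.equivFin V v).isLt
    simp only [hl_def]
    omega
  have h := exists_of_injOn (K := Fintype.card V + 2) G S.toFinset (by simpa using hS)
    hl.injOn fun v _ => hK v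
  rw [Set.coe_toFinset] at h
  refine ⟨_, (h.relabel_finset (Function.extend l t 0) (Finset.univ.image l) ?_).congr
    (fun _ _ _ _ => Iff.rfl) ?_⟩
  · intro x hx
    obtain ⟨v, -, rfl⟩ := Finset.mem_image.1 hx
    have := ht v
    refine ⟨hK v, ?_, ?_⟩
    · rw [hl.extend_apply]
      omega
    · rw [hl.extend_apply, Finset.mem_image]
      rintro ⟨w, -, hw⟩
      simp only [hl_def] at hw
      omega
  · intro v _
    simp [hl.extend_apply]

/-- Composing a split labeled graph on `T` with an arbitrary graph on `S`. -/
theorem compose {G : SimpleGraph V} {A : Set V} [DecidablePred (· ∈ A)] (hK : 3 ≤ K)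
    (hd : Disjoint T S) (hT : Builds K G.Adj T fun v => if v ∈ A then 0 else 1)
    (hS : Builds K G.Adj S l) (hA : ∀ u ∈ S, ∀ v ∈ T, (G.Adj u v ↔ v ∈ A)) :
    Builds K G.Adj (T ∪ S) (fun _ => 0) := by
  classical
  have hne : ∀ v ∈ T, v ∉ S := fun v h h' => Set.disjoint_left.1 hd h h'
  set l₀ : V → ℕ := fun v => if v ∈ S then 2 else if v ∈ A then 0 else 1 with hl₀
  set R₀ : V → V → Prop := fun u v => G.Adj u v ∧ (u ∈ S ↔ v ∈ S) with hR₀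
  have hT' : Builds K R₀ T l₀ := by
    refine hT.congr (fun u hu v hv => ?_) fun v hv => ?_
    · simp [hR₀, hne u hu, hne v hv]
    · simp [hl₀, hne v hv]
  have hS' : Builds K R₀ S l₀ := by
    refine (hS.const_label (c := 2) (by omega)).congr (fun u hu v hv => ?_) fun v hv => ?_
    · simp [hR₀, hu, hv]
    · simp [hl₀, hv]
  have hTS : Builds K R₀ (T ∪ S) l₀ := hT'.union hS' hd fun u hu v hv => by
    simp [hR₀, hne u hu, hv]
  refine ((hTS.join (i := 0) (j := 2) (by omega) (by omega) (by omega)).const_label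
    (c := 0) (by omega)).congr ?_ fun _ _ => rfl
  rintro u (hu | hu) v (hv | hv)
  · simp only [hl₀, hR₀, hne u hu, hne v hv, if_false]
    split_ifs <;> simp
  · have := hA v hv u hu
    rw [G.adj_comm] at this
    by_cases h : u ∈ A <;> simp [hl₀, hR₀, hne u hu, hv, this, h]
  · have := hA u hu v hv
    by_cases h : v ∈ A <;> simp [hl₀, hR₀, hne v hv, hu, this, h]
  · simp [hl₀, hR₀, hu, hv]

end Builds

section Widths

variable {V : Type*} (G : SimpleGraph V) {S : Set V}

theorem exists_builds_cliqueWidth [Finite V] (hS : S.Nonempty) :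
    ∃ l, Builds (cliqueWidth (G.induce S)) G.Adj S l := by
  classical
  have hne : {k | ∃ e : Expr, e.Valid k ∧ e.Constructs (G.induce S)}.Nonempty := by
    obtain ⟨K, e, he, f, hf, -⟩ :=
      Builds.exists_labels_zero_one G hS (fun _ => 0) fun _ => two_pos
    exact ⟨K, e, he, f, hf⟩
  obtain ⟨e, he, f, hf⟩ := Nat.sInf_mem hne
  exact ⟨fun v => if h : v ∈ S then e.label (f.symm ⟨v, h⟩) else 0, e, he, f, hf,
    fun u => by simp⟩

theorem builds_splitCliqueWidth [Finite V] {A : Set V} [DecidablePred (· ∈ A)] (hS : S.Nonempty) :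
    Builds (splitCliqueWidth (G.induce S) (Subtype.val ⁻¹' A) (Subtype.val ⁻¹' (S \ A)))
      G.Adj S fun v => if v ∈ A then 0 else 1 := by
  have hne : {k | ∃ e : Expr, e.Valid k ∧ e.ConstructsSplit (G.induce S)
      (Subtype.val ⁻¹' A) (Subtype.val ⁻¹' (S \ A))}.Nonempty := by
    obtain ⟨K, e, he, f, hf, hl⟩ :=
      Builds.exists_labels_zero_one G hS (fun v => if v ∈ A then 0 else 1) fun v => by
        split_ifs <;> omega
    refine ⟨K, e, he, f, hf, fun u => ⟨fun h => ?_, fun h => ?_⟩⟩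
    · exact (hl u).trans (if_pos h)
    · exact (hl u).trans (if_neg h.2)
  obtain ⟨e, he, f, hf, hl⟩ := Nat.sInf_mem hne
  refine ⟨e, he, f, hf, fun u => ?_⟩
  by_cases h : (f u : V) ∈ A
  · exact ((hl u).1 h).trans (if_pos h).symm
  · exact ((hl u).2 ⟨(f u).2, h⟩).trans (if_neg h).symm

theorem cliqueWidth_eq_zero_of_isEmpty [IsEmpty V] : cliqueWidth G = 0 := by
  refine Nat.sInf_eq_zero.2 (Or.inr (Set.eq_empty_of_forall_notMem ?_))
  rintro k ⟨e, -, f, -⟩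
  exact isEmptyElim (f e.nonempty_verts.some)

theorem cliqueWidth_le_of_builds {K : ℕ} {l : V → ℕ} (h : Builds K G.Adj Set.univ l) :
    cliqueWidth G ≤ K := by
  obtain ⟨e, he, f, hf, -⟩ := h
  exact Nat.sInf_le ⟨e, he, f.trans (Equiv.Set.univ V), hf⟩

end Widths

theorem stmt1 {V : Type} [Fintype V] (G : SimpleGraph V) (k : ℕ)
    (P A : Fin (k + 1) → Set V)
    (hdisj : ∀ i j, i ≠ j → Disjoint (P i) (P j))
    (hcover : (⋃ i, P i) = Set.univ)
    (hA : ∀ i, A i ⊆ P i)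
    (hsplit : ∀ i, i ≠ 0 →
      IsSplitted (G.induce (P i)) (Subtype.val ⁻¹' A i) (Subtype.val ⁻¹' (P i \ A i)))
    (hcross : ∀ i j : Fin (k + 1), i < j → ∀ u ∈ P i, ∀ v ∈ P j, (G.Adj u v ↔ v ∈ A j)) :
    cliqueWidth G ≤
      max 4 (max
        ((Finset.univ.erase (0 : Fin (k + 1))).sup fun i =>
          splitCliqueWidth (G.induce (P i)) (Subtype.val ⁻¹' A i)
            (Subtype.val ⁻¹' (P i \ A i)))
        (cliqueWidth (G.induce (P 0)))) := by
  classical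
  set K := max 4 (max
    ((Finset.univ.erase (0 : Fin (k + 1))).sup fun i =>
      splitCliqueWidth (G.induce (P i)) (Subtype.val ⁻¹' A i)
        (Subtype.val ⁻¹' (P i \ A i)))
    (cliqueWidth (G.induce (P 0)))) with hK
  have hK4 : 4 ≤ K := le_max_left _ _
  have hK0 : cliqueWidth (G.induce (P 0)) ≤ K := (le_max_right _ _).trans (le_max_right _ _)
  have hKi : ∀ i, i ≠ 0 → splitCliqueWidth (G.induce (P i)) (Subtype.val ⁻¹' A i)
      (Subtype.val ⁻¹' (P i \ A i)) ≤ K := fun i hi =>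
    (Finset.le_sup (f := fun i => splitCliqueWidth (G.induce (P i)) (Subtype.val ⁻¹' A i)
      (Subtype.val ⁻¹' (P i \ A i))) (Finset.mem_erase.2 ⟨hi, Finset.mem_univ i⟩)).trans
      ((le_max_left _ _).trans (le_max_right _ _))
  have main : ∀ n : Fin (k + 1), (⋃ j ≤ n, P j) = ∅ ∨
      Builds K G.Adj (⋃ j ≤ n, P j) fun _ => 0 := by
    intro n
    induction n using Fin.induction with
    | zero =>
      have h0 : (⋃ j ≤ (0 : Fin (k + 1)), P j) = P 0 := by simp
      rw [h0]
      rcases (P 0).eq_empty_or_nonempty with h | h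
      · exact Or.inl h
      · obtain ⟨l, hl⟩ := exists_builds_cliqueWidth G h
        exact Or.inr ((hl.mono hK0).const_label (by omega))
    | succ n ih =>
      have hS : (⋃ j ≤ n.succ, P j) = P n.succ ∪ ⋃ j ≤ n.castSucc, P j := by
        ext v
        simp only [Set.mem_iUnion, Set.mem_union, exists_prop]
        constructor
        · rintro ⟨j, hj, hv⟩
          rcases hj.eq_or_lt with rfl | hj
          · exact Or.inl hv
          · exact Or.inr ⟨j, Fin.le_castSucc_iff.2 hj, hv⟩
        · rintro (hv | ⟨j, hj, hv⟩)
          · exact ⟨_, le_rfl, hv⟩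
          · exact ⟨j, (Fin.le_castSucc_iff.1 hj).le, hv⟩
      rw [hS]
      rcases (P n.succ).eq_empty_or_nonempty with h | h
      · rwa [h, Set.empty_union]
      have hT := (builds_splitCliqueWidth G (A := A n.succ) h).mono
        (hKi _ (Fin.succ_ne_zero n))
      refine Or.inr ?_
      rcases ih with ih | ih
      · rw [ih, Set.union_empty]
        exact hT.const_label (by omega)
      · refine Builds.compose (by omega) ?_ hT ih ?_
        · simp only [Set.disjoint_iUnion_right]
          intro j hj
          exact hdisj _ _ (Fin.le_castSucc_iff.1 hj).ne'
        · intro u hu v hv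
          simp only [Set.mem_iUnion, exists_prop] at hu
          obtain ⟨j, hj, hu⟩ := hu
          exact hcross j _ (Fin.le_castSucc_iff.1 hj) u hu v hv
  have hlast : (⋃ j ≤ Fin.last k, P j) = Set.univ := by
    simpa [Fin.le_last] using hcover
  rcases hlast ▸ main (Fin.last k) with h | h
  · have : IsEmpty V := Set.univ_eq_empty_iff.1 h
    rw [cliqueWidth_eq_zero_of_isEmpty]
    exact Nat.zero_le _
  · exact cliqueWidth_le_of_builds G h


end CWPaper
end

section
/- For every m ≥ 1, the clique-width of the complement of U_3(m) is at most 3. -/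
namespace CWPaper

namespace Expr

/-- The expression `e` builds, up to isomorphism, the graph on `V` with vertex labels `l` and
adjacency relation `R`. -/
def Builds (e : Expr) {V : Type*} (l : V → ℕ) (R : V → V → Prop) : Prop :=
  ∃ f : e.Verts ≃ V, (∀ u, l (f u) = e.label u) ∧ ∀ u v, R (f u) (f v) ↔ e.adj u v

namespace Builds

variable {V W : Type*} {a b : Expr} {l : V → ℕ} {R : V → V → Prop} {l' : W → ℕ}
  {R' : W → W → Prop}

theorem vert (i : ℕ) : (vert i).Builds (fun _ : Unit => i) (fun _ _ => False) :=
  ⟨Equiv.refl Unit, fun _ => rfl, fun _ _ => Iff.rfl⟩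

theorem union (ha : a.Builds l R) (hb : b.Builds l' R') :
    (a.union b).Builds (Sum.elim l l') (Sum.LiftRel R R') := by
  obtain ⟨f, hf, hfR⟩ := ha
  obtain ⟨g, hg, hgR⟩ := hb
  refine ⟨Equiv.sumCongr f g, ?_, ?_⟩
  · rintro (u | u)
    exacts [hf u, hg u]
  · rintro (u | u) (v | v)
    · exact Sum.liftRel_inl_inl.trans (hfR u v)
    · exact iff_of_false Sum.not_liftRel_inl_inr id
    · exact iff_of_false Sum.not_liftRel_inr_inl id
    · exact Sum.liftRel_inr_inr.trans (hgR u v)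

theorem join (ha : a.Builds l R) (i j : ℕ) :
    (a.join i j).Builds l
      (fun u v => R u v ∨ (l u = i ∧ l v = j) ∨ (l u = j ∧ l v = i)) := by
  obtain ⟨f, hf, hfR⟩ := ha
  have key (u v : a.Verts) : (R (f u) (f v) ∨ (l (f u) = i ∧ l (f v) = j) ∨
      (l (f u) = j ∧ l (f v) = i)) ↔ (a.join i j).adj u v := by
    rw [hf, hf, hfR]
    rfl
  exact ⟨f, hf, key⟩

theorem relabel (ha : a.Builds l R) (i j : ℕ) :
    (a.relabel i j).Builds (fun u => if l u = i then j else l u) R := by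
  obtain ⟨f, hf, hfR⟩ := ha
  have key (u : a.Verts) :
      (if l (f u) = i then j else l (f u)) = (a.relabel i j).label u := by
    rw [hf]
    rfl
  exact ⟨f, key, hfR⟩

theorem of_bijective (ha : a.Builds l R) {g : V → W} (hg : g.Bijective)
    (hl : ∀ u, l' (g u) = l u) (hR : ∀ u v, R' (g u) (g v) ↔ R u v) : a.Builds l' R' := by
  obtain ⟨f, hf, hfR⟩ := ha
  exact ⟨f.trans (Equiv.ofBijective g hg), fun u => (hl _).trans (hf u),
    fun u v => (hR _ _).trans (hfR u v)⟩

end Builds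

/-- An expression for the cocktail party graph on `n + 1` pairs, with all labels `0`. -/
def cocktail : ℕ → Expr
  | 0 => union (vert 0) (vert 0)
  | n + 1 => relabel 1 0 (join 0 1 (union (cocktail n) (union (vert 1) (vert 1))))

theorem cocktail_valid (n : ℕ) : (cocktail n).Valid 3 := by
  induction n with
  | zero => simp [cocktail, Valid]
  | succ n ih => simp [cocktail, Valid, ih]

theorem cocktail_builds (n : ℕ) :
    (cocktail n).Builds (fun _ : Fin (n + 1) × Fin 2 => 0) (fun u v => u.1 ≠ v.1) := by
  induction n with
  | zero =>
    let g : Unit ⊕ Unit → Fin 1 × Fin 2 := Sum.elim (fun _ => (0, 0)) (fun _ => (0, 1))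
    refine ((Builds.vert 0).union (Builds.vert 0)).of_bijective (g := g) (by decide) ?_ ?_
    · rintro (_ | _) <;> rfl
    · rintro (_ | _) (_ | _) <;> simp [g]
  | succ n ih =>
    let g : Fin (n + 1) × Fin 2 ⊕ (Unit ⊕ Unit) → Fin (n + 2) × Fin 2 :=
      Sum.elim (fun u => (u.1.castSucc, u.2))
        (Sum.elim (fun _ => (Fin.last _, 0)) (fun _ => (Fin.last _, 1)))
    have hg : g.Bijective := by
      constructor
      · rintro (u | (_ | _)) (v | (_ | _)) h <;>
          simp_all [g, Prod.ext_iff, Fin.castSucc_ne_last, (Fin.castSucc_ne_last _).symm]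
      · rintro ⟨i, x⟩
        induction i using Fin.lastCases with
        | last =>
          fin_cases x
          exacts [⟨.inr (.inl ()), rfl⟩, ⟨.inr (.inr ()), rfl⟩]
        | cast i => exact ⟨.inl (i, x), rfl⟩
    refine (((ih.union ((Builds.vert 1).union (Builds.vert 1))).join 0 1).relabel 1
      0).of_bijective hg ?_ ?_
    · rintro (u | (_ | _)) <;> rfl
    · rintro (u | (_ | _)) (v | (_ | _)) <;>
        simp [g, Fin.castSucc_ne_last, (Fin.castSucc_ne_last _).symm]

/-- An expression for the complement of `U3 (n + 1)`.  Before the outermost join, the vertices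
of the triangles are labeled `0`, the path of the `C₄` is labeled `1` and the hub is
labeled `2`. -/
def complU3 (n : ℕ) : Expr :=
  join 0 1 (union (cocktail n)
    (union (relabel 2 1 (join 1 2 (union (vert 1) (vert 2))))
      (join 1 2 (union (vert 1) (vert 2)))))

theorem complU3_valid (n : ℕ) : (complU3 n).Valid 3 := by
  simp [complU3, Valid, cocktail_valid]

theorem complU3_constructs (n : ℕ) : (complU3 n).Constructs (U3 (n + 1))ᶜ := by
  let g : Fin (n + 1) × Fin 2 ⊕ ((Unit ⊕ Unit) ⊕ (Unit ⊕ Unit)) →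
      Option (Fin 3 ⊕ Fin (n + 1) × Fin 2) :=
    Sum.elim (fun u => some (.inr u))
      (Sum.elim (Sum.elim (fun _ => some (.inl 0)) (fun _ => some (.inl 2)))
        (Sum.elim (fun _ => some (.inl 1)) (fun _ => none)))
  let l : Option (Fin 3 ⊕ Fin (n + 1) × Fin 2) → ℕ
    | none => 2
    | some (.inl _) => 1
    | some (.inr _) => 0
  have hg : g.Bijective := by
    constructor
    · rintro (u | ((_ | _) | (_ | _))) (v | ((_ | _) | (_ | _))) h <;> simp_all [g]
    · rintro (_ | (i | p))
      · exact ⟨.inr (.inr (.inr ())), rfl⟩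
      · fin_cases i
        exacts [⟨.inr (.inl (.inl ())), rfl⟩, ⟨.inr (.inr (.inl ())), rfl⟩,
          ⟨.inr (.inl (.inr ())), rfl⟩]
      · exact ⟨.inl p, rfl⟩
  have hpair := ((Builds.vert 1).union (Builds.vert 2)).join 1 2
  have h : (complU3 n).Builds l (U3 (n + 1))ᶜ.Adj := by
    refine (((cocktail_builds n).union ((hpair.relabel 2 1).union hpair)).join 0
      1).of_bijective hg ?_ ?_
    · rintro (u | ((_ | _) | (_ | _))) <;> rfl
    · rintro (u | ((_ | _) | (_ | _))) (v | ((_ | _) | (_ | _))) <;> simp [g, U3]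
      grind
  obtain ⟨f, -, hf⟩ := h
  exact ⟨f, hf⟩

end Expr

theorem stmt8 (m : ℕ) (hm : 1 ≤ m) : cliqueWidth (U3 m)ᶜ ≤ 3 := by
  obtain ⟨n, rfl⟩ := Nat.exists_eq_add_of_le' hm
  exact Nat.sInf_le ⟨Expr.complU3 n, Expr.complU3_valid n, Expr.complU3_constructs n⟩

end CWPaper
end

section
/- Let G be a finite simple graph such that G or its complement is isomorphic to one of the following graphs: C_5, mK_2 with m ≥ 2, U_2(m, s) with m ≥ 1 and s ≥ 2, or U_3(m) with m ≥ 1. Then the clique-width of G is at most 3. -/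
namespace CWPaper

section Buildable

open Set

/-- Some `k`-expression builds the labeled graph on the vertex set `S` with adjacency relation `A`
and labels `L`, or `S` is empty. -/
def Buildable {V : Type*} (k : ℕ) (A : V → V → Prop) (S : Set V) (L : V → ℕ) : Prop :=
  S = ∅ ∨ ∃ e : Expr, e.Valid k ∧ ∃ f : e.Verts → V, Function.Injective f ∧ range f = S ∧
    (∀ u v, A (f u) (f v) ↔ e.adj u v) ∧ ∀ u, e.label u = L (f u)

namespace Buildable

variable {V : Type*} {k : ℕ} {A A' : V → V → Prop} {S T : Set V} {L L' : V → ℕ}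

theorem empty : Buildable k A ∅ L := Or.inl rfl

theorem congr (h : Buildable k A S L) (hA : ∀ u ∈ S, ∀ v ∈ S, A' u v ↔ A u v)
    (hL : ∀ u ∈ S, L' u = L u) : Buildable k A' S L' := by
  obtain rfl | ⟨e, he, f, hf, rfl, hadj, hlab⟩ := h
  · exact empty
  · refine Or.inr ⟨e, he, f, hf, rfl, fun u v => ?_, fun u => ?_⟩
    · rw [hA _ ⟨u, rfl⟩ _ ⟨v, rfl⟩, hadj]
    · rw [hL _ ⟨u, rfl⟩, hlab]

theorem singleton {v : V} (hA : ¬ A v v) (hv : L v < k) : Buildable k A {v} L := by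
  refine Or.inr ⟨.vert (L v), hv, fun _ => v, ?_, ?_, ?_, fun _ => rfl⟩
  · intro _ _ _
    rfl
  · ext w
    exact ⟨fun ⟨_, h⟩ => h.symm, fun h => ⟨(), h.symm⟩⟩
  · exact fun _ _ => ⟨fun h => hA h, fun h => h.elim⟩

theorem relabel (h : Buildable k A S L) {i j : ℕ} (hi : i < k) (hj : j < k)
    (hL : ∀ u ∈ S, L' u = if L u = i then j else L u) : Buildable k A S L' := by
  obtain rfl | ⟨e, he, f, hf, rfl, hadj, hlab⟩ := h
  · exact empty
  · refine Or.inr ⟨.relabel i j e, ⟨hi, hj, he⟩, f, hf, rfl, hadj, fun u => ?_⟩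
    change (if e.label u = i then j else e.label u) = L' (f u)
    rw [hL _ ⟨u, rfl⟩, hlab u]

theorem join (h : Buildable k A S L) {i j : ℕ} (hi : i < k) (hj : j < k) (hij : i ≠ j) :
    Buildable k (fun u v => A u v ∨ (L u = i ∧ L v = j) ∨ (L u = j ∧ L v = i)) S L := by
  obtain rfl | ⟨e, he, f, hf, rfl, hadj, hlab⟩ := h
  · exact empty
  · refine Or.inr ⟨.join i j e, ⟨hi, hj, hij, he⟩, f, hf, rfl, fun u v => ?_, hlab⟩
    change _ ↔ e.adj u v ∨ (e.label u = i ∧ e.label v = j) ∨ (e.label u = j ∧ e.label v = i)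
    rw [← hadj u v, hlab u, hlab v]

theorem joins (h : Buildable k A S L) (J : List (ℕ × ℕ))
    (hJ : ∀ p ∈ J, p.1 < k ∧ p.2 < k ∧ p.1 ≠ p.2) :
    Buildable k
      (fun u v => A u v ∨ ∃ p ∈ J, (L u = p.1 ∧ L v = p.2) ∨ (L u = p.2 ∧ L v = p.1)) S L := by
  induction J with
  | nil => simpa using h
  | cons p J ih =>
    obtain ⟨h1, h2, h3⟩ := hJ p (by simp)
    refine ((ih fun q hq => hJ q (by simp [hq])).join h1 h2 h3).congr (fun u _ v _ => ?_)
      (fun _ _ => rfl)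
    rw [List.exists_mem_cons_iff, ← or_assoc, or_right_comm]

theorem disjUnion (hS : Buildable k A S L) (hT : Buildable k A T L) (hST : Disjoint S T) :
    Buildable k (fun u v => A u v ∧ ((u ∈ S ∧ v ∈ S) ∨ (u ∈ T ∧ v ∈ T))) (S ∪ T) L := by
  by_cases hS0 : S = ∅
  · subst hS0
    rw [empty_union]
    exact hT.congr (fun u hu v hv => by simp [hu, hv]) fun _ _ => rfl
  by_cases hT0 : T = ∅
  · subst hT0
    rw [union_empty]
    exact hS.congr (fun u hu v hv => by simp [hu, hv]) fun _ _ => rfl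
  obtain ⟨e, he, f, hf, rfl, hadj, hlab⟩ := hS.resolve_left hS0
  obtain ⟨e', he', f', hf', rfl, hadj', hlab'⟩ := hT.resolve_left hT0
  have hd : ∀ u v, f u ≠ f' v := fun u v huv =>
    Set.disjoint_left.1 hST ⟨u, rfl⟩ ⟨v, huv.symm⟩
  have hd' : ∀ u v, f' v ≠ f u := fun u v huv => hd u v huv.symm
  refine Or.inr ⟨.union e e', ⟨he, he'⟩, Sum.elim f f', ?_, ?_, ?_, ?_⟩
  · exact hf.sumElim hf' hd
  · exact Sum.elim_range f f'
  · rintro (u | u) (v | v)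
    · simp [Expr.adj, hadj]
    · simp [Expr.adj, hd, hd']
    · simp [Expr.adj, hd, hd']
    · simp [Expr.adj, hadj']
  · rintro (u | u)
    · exact hlab u
    · exact hlab' u

/-- Take the disjoint union of two labeled graphs and perform the joins listed in `J`. -/
theorem unionJoins {G : SimpleGraph V} (hS : Buildable k G.Adj S L)
    (hT : Buildable k G.Adj T L) (hST : Disjoint S T) (J : List (ℕ × ℕ))
    (hJ : ∀ p ∈ J, p.1 < k ∧ p.2 < k ∧ p.1 ≠ p.2)
    (hsound : ∀ p ∈ J, ∀ u ∈ S ∪ T, ∀ v ∈ S ∪ T, L u = p.1 → L v = p.2 → G.Adj u v)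
    (hcomplete : ∀ u ∈ S, ∀ v ∈ T, G.Adj u v →
      ∃ p ∈ J, (L u = p.1 ∧ L v = p.2) ∨ (L u = p.2 ∧ L v = p.1)) :
    Buildable k G.Adj (S ∪ T) L := by
  refine ((hS.disjUnion hT hST).joins J hJ).congr (fun u hu v hv => ⟨fun h => ?_, ?_⟩)
    (fun _ _ => rfl)
  · obtain hu | hu := hu <;> obtain hv | hv := hv
    · exact Or.inl ⟨h, Or.inl ⟨hu, hv⟩⟩
    · exact Or.inr (hcomplete u hu v hv h)
    · obtain ⟨p, hp, hp'⟩ := hcomplete v hv u hu h.symm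
      exact Or.inr ⟨p, hp, by tauto⟩
    · exact Or.inl ⟨h, Or.inr ⟨hu, hv⟩⟩
  · rintro (⟨h, -⟩ | ⟨p, hp, ⟨h1, h2⟩ | ⟨h1, h2⟩⟩)
    · exact h
    · exact hsound p hp u hu v hv h1 h2
    · exact (hsound p hp v hv u hu h2 h1).symm

theorem union {G : SimpleGraph V} (hS : Buildable k G.Adj S L)
    (hT : Buildable k G.Adj T L) (hST : Disjoint S T)
    (hno : ∀ u ∈ S, ∀ v ∈ T, ¬ G.Adj u v) : Buildable k G.Adj (S ∪ T) L :=
  hS.unionJoins hT hST [] (by simp) (by simp) fun u hu v hv h => (hno u hu v hv h).elim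

/-- Join a graph with all labels `2` to a graph with labels `0` and `1`, then relabel `2` to `0`. -/
theorem completeJoin {G : SimpleGraph V} (hS : Buildable 3 G.Adj S L)
    (hT : Buildable 3 G.Adj T fun _ => 2) (hST : Disjoint S T)
    (hall : ∀ u ∈ S, ∀ v ∈ T, G.Adj u v) (hLS : ∀ u ∈ S, L u < 2) (hLT : ∀ u ∈ T, L u = 0) :
    Buildable 3 G.Adj (S ∪ T) L := by
  classical
  have hdis : ∀ u ∈ S, u ∉ T := fun u hu => Set.disjoint_left.1 hST hu
  have key : Buildable 3 G.Adj (S ∪ T) fun u => if u ∈ T then 2 else L u := by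
    refine unionJoins (hS.congr (fun _ _ _ _ => Iff.rfl) fun u hu => if_neg (hdis u hu))
      (hT.congr (fun _ _ _ _ => Iff.rfl) fun u hu => if_pos hu) hST [(0, 2), (1, 2)] (by simp)
      ?_ ?_
    · have hside : ∀ u ∈ S ∪ T, (if u ∈ T then 2 else L u) < 2 → u ∈ S := by
        rintro u (hu | hu) h
        · exact hu
        · simp [hu] at h
      have hside' : ∀ u ∈ S ∪ T, (if u ∈ T then 2 else L u) = 2 → u ∈ T := by
        rintro u (hu | hu) h
        · rw [if_neg (hdis u hu)] at h
          exact absurd (hLS u hu) (by lia)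
        · exact hu
      intro p hp u hu v hv h1 h2
      simp only [List.mem_cons, List.not_mem_nil, or_false] at hp
      obtain rfl | rfl := hp
      · exact hall u (hside u hu (by rw [h1]; decide)) v (hside' v hv h2)
      · exact hall u (hside u hu (by rw [h1]; decide)) v (hside' v hv h2)
    · intro u hu v hv _
      have := hLS u hu
      simp only [hv, hdis u hu, if_true, if_false, List.mem_cons, List.not_mem_nil, or_false,
        exists_eq_or_imp, exists_eq_left]
      lia
  refine key.relabel (i := 2) (j := 0) (by decide) (by decide) ?_
  rintro u (hu | hu)
  · have := hLS u hu
    rw [if_neg (hdis u hu), if_neg (by lia)]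
  · simp [hu, hLT u hu]

theorem edge {G : SimpleGraph V} {x y : V} (h : G.Adj x y) (hx : L x = 0) (hy : L y = 0) :
    Buildable 3 G.Adj {x, y} L := by
  have hx' : Buildable 3 G.Adj {x} L := singleton (G.loopless.irrefl x) (by lia)
  have hy' : Buildable 3 G.Adj {y} (fun _ => 2) := singleton (G.loopless.irrefl y) (by decide)
  exact hx'.completeJoin hy' (by simpa using h.ne) (by simpa using h) (by simp [hx]) (by simp [hy])

theorem nonEdge {G : SimpleGraph V} {x y : V} (hxy : x ≠ y) (h : ¬ G.Adj x y) (hx : L x < k)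
    (hy : L y < k) : Buildable k G.Adj {x, y} L :=
  (singleton (G.loopless.irrefl x) hx).union (singleton (G.loopless.irrefl y) hy)
    (by simpa using hxy) (by simpa using h)

theorem iUnion {ι : Type*} [Finite ι] {G : SimpleGraph V} (P : ι → Set V)
    (hS : Buildable k G.Adj S L) (hP : ∀ i, Buildable k G.Adj (P i) L)
    (hSP : ∀ i, Disjoint S (P i)) (hPP : ∀ i j, i ≠ j → Disjoint (P i) (P j))
    (hnoS : ∀ i, ∀ u ∈ S, ∀ v ∈ P i, ¬ G.Adj u v)
    (hnoP : ∀ i j, i ≠ j → ∀ u ∈ P i, ∀ v ∈ P j, ¬ G.Adj u v) :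
    Buildable k G.Adj (S ∪ ⋃ i, P i) L := by
  classical
  have := Fintype.ofFinite ι
  have key : ∀ I : Finset ι, Buildable k G.Adj (S ∪ ⋃ i ∈ I, P i) L := by
    intro I
    induction I using Finset.induction_on with
    | empty => simpa using hS
    | insert a I ha ih =>
      have hne : ∀ i ∈ I, i ≠ a := fun i hi hia => ha (hia ▸ hi)
      rw [Finset.set_biUnion_insert, union_comm (P a), ← union_assoc]
      refine ih.union (hP a) ?_ ?_
      · simp only [disjoint_union_left, disjoint_iUnion_left]
        exact ⟨hSP a, fun i hi => hPP i a (hne i hi)⟩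
      · rintro u (hu | hu)
        · exact hnoS a u hu
        · obtain ⟨i, hi, hu⟩ := mem_iUnion₂.1 hu
          exact hnoP i a (hne i hi) u hu
  simpa using key Finset.univ

theorem iUnion_completeJoin {ι : Type*} [Finite ι] {G : SimpleGraph V} (P : ι → Set V)
    (hS : Buildable 3 G.Adj S L) (hP : ∀ i, Buildable 3 G.Adj (P i) fun _ => 2)
    (hSP : ∀ i, Disjoint S (P i)) (hPP : ∀ i j, i ≠ j → Disjoint (P i) (P j))
    (hallS : ∀ i, ∀ u ∈ S, ∀ v ∈ P i, G.Adj u v)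
    (hallP : ∀ i j, i ≠ j → ∀ u ∈ P i, ∀ v ∈ P j, G.Adj u v)
    (hLS : ∀ u ∈ S, L u < 2) (hLP : ∀ i, ∀ u ∈ P i, L u = 0) :
    Buildable 3 G.Adj (S ∪ ⋃ i, P i) L := by
  classical
  have := Fintype.ofFinite ι
  have key : ∀ I : Finset ι, Buildable 3 G.Adj (S ∪ ⋃ i ∈ I, P i) L := by
    intro I
    induction I using Finset.induction_on with
    | empty => simpa using hS
    | insert a I ha ih =>
      have hne : ∀ i ∈ I, i ≠ a := fun i hi hia => ha (hia ▸ hi)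
      rw [Finset.set_biUnion_insert, union_comm (P a), ← union_assoc]
      refine ih.completeJoin (hP a) ?_ ?_ ?_ (hLP a)
      · simp only [disjoint_union_left, disjoint_iUnion_left]
        exact ⟨hSP a, fun i hi => hPP i a (hne i hi)⟩
      · rintro u (hu | hu)
        · exact hallS a u hu
        · obtain ⟨i, hi, hu⟩ := mem_iUnion₂.1 hu
          exact hallP i a (hne i hi) u hu
      · rintro u (hu | hu)
        · exact hLS u hu
        · obtain ⟨i, hi, hu⟩ := mem_iUnion₂.1 hu
          rw [hLP i u hu]
          decide
  simpa using key Finset.univ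

theorem cliqueWidth_le {W : Type*} {G : SimpleGraph W} {H : SimpleGraph V}
    (h : Buildable k H.Adj univ L) (φ : G ≃g H) : cliqueWidth G ≤ k := by
  obtain hV | ⟨e, he, f, hf, hrange, hadj, -⟩ := h
  · have : IsEmpty V := univ_eq_empty_iff.1 hV
    have : IsEmpty W := φ.toEquiv.isEmpty
    have hno : {k | ∃ e : Expr, e.Valid k ∧ e.Constructs G} = ∅ := by
      refine eq_empty_of_forall_notMem ?_
      rintro j ⟨e, -, f, -⟩
      have hne : ∀ e : Expr, Nonempty e.Verts := by
        intro e
        induction e with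
        | vert i => exact ⟨()⟩
        | union a b iha _ => exact iha.map Sum.inl
        | join i j a ih => exact ih
        | relabel i j a ih => exact ih
      exact (hne e).elim fun v => isEmptyElim (f v)
    simp [cliqueWidth, hno]
  · refine Nat.sInf_le ⟨e, he, ?_⟩
    refine ⟨(Equiv.ofBijective f ⟨hf, range_eq_univ.1 hrange⟩).trans φ.symm.toEquiv,
      fun u v => ?_⟩
    rw [← hadj, ← φ.symm.map_adj_iff]
    rfl

end Buildable

/-- Complementary graphs of isomorphic graphs are isomorphic. -/
def isoCompl {V W : Type*} {G : SimpleGraph V} {H : SimpleGraph W} (φ : Gᶜ ≃g H) : G ≃g Hᶜ where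
  toEquiv := φ.toEquiv
  map_rel_iff' {a b} := by
    have := φ.map_adj_iff (v := a) (w := b)
    simp only [SimpleGraph.compl_adj] at this ⊢
    by_cases hab : a = b
    · simp [hab]
    · have h1 : φ a ≠ φ b := fun h => hab (φ.injective h)
      change φ a ≠ φ b ∧ ¬ H.Adj (φ a) (φ b) ↔ _
      tauto

def cycleFiveSelfCompl : (SimpleGraph.cycleGraph 5)ᶜ ≃g SimpleGraph.cycleGraph 5 where
  toFun x := 2 * x
  invFun x := 3 * x
  left_inv := by decide
  right_inv := by decide
  map_rel_iff' := by decide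

theorem buildable_cycleFive :
    Buildable 3 (SimpleGraph.cycleGraph 5).Adj univ ![0, 1, 1, 0, 2] := by
  have e1 : Buildable 3 (SimpleGraph.cycleGraph 5).Adj ({0} ∪ {1}) ![0, 1, 2, 0, 2] := by
    refine .unionJoins (.singleton ?_ ?_) (.singleton ?_ ?_) ?_ [(0, 1)] ?_ ?_ ?_
    all_goals simp
    decide
  have e2 : Buildable 3 (SimpleGraph.cycleGraph 5).Adj ({2} ∪ {3}) ![0, 1, 2, 0, 2] := by
    refine .unionJoins (.singleton ?_ ?_) (.singleton ?_ ?_) ?_ [(0, 2)] ?_ ?_ ?_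
    all_goals simp
    decide
  have p4 := e1.unionJoins e2 (by simp) [(1, 2)] (by simp) (by simp; decide) (by simp; decide)
  have p4' := p4.relabel (L' := ![0, 1, 1, 0, 2]) (i := 2) (j := 1) (by decide) (by decide)
    (by simp)
  have h4 : Buildable 3 (SimpleGraph.cycleGraph 5).Adj {4} ![0, 1, 1, 0, 2] :=
    .singleton (by decide) (by decide)
  have := p4'.unionJoins h4 (by simp) [(0, 2)] (by simp) (by simp; decide) (by simp; decide)
  convert this using 1
  ext x
  fin_cases x <;> simp

theorem buildable_mK2 (m : ℕ) : Buildable 3 (mK2 m).Adj univ fun _ => 0 := by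
  have h := Buildable.iUnion (G := mK2 m) (L := fun _ => 0) (S := ∅)
    (fun i : Fin m => {(i, 0), (i, 1)}) .empty (fun i => .edge (by simp [mK2]) rfl rfl)
    (by simp) (by simp +contextual [eq_comm]) (by simp) (by simp +contextual [mK2, eq_comm])
  convert h using 1
  ext ⟨i, x⟩
  fin_cases x <;> simp

theorem buildable_compl_mK2 (m : ℕ) : Buildable 3 (mK2 m)ᶜ.Adj univ fun _ => 0 := by
  have h := Buildable.iUnion_completeJoin (G := (mK2 m)ᶜ) (L := fun _ => 0) (S := ∅)
    (fun i : Fin m => {(i, 0), (i, 1)}) .empty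
    (fun i => .nonEdge (by simp) (by simp [mK2]) (by decide) (by decide))
    (by simp) (by simp +contextual [eq_comm]) (by simp) (by simp +contextual [mK2, eq_comm])
    (by simp) (by simp)
  convert h using 1
  ext ⟨i, x⟩
  fin_cases x <;> simp

/-- The label `1` is used for the center of the star. -/
def U2Label (m s : ℕ) : (Fin m × Fin 2) ⊕ Option (Fin s) → ℕ
  | .inr none => 1
  | _ => 0

theorem univ_U2 (m s : ℕ) : (univ : Set ((Fin m × Fin 2) ⊕ Option (Fin s))) =
    (((∅ ∪ ⋃ j : Fin s, {.inr (some j)}) ∪ {.inr none}) ∪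
      ⋃ i : Fin m, {.inl (i, 0), .inl (i, 1)}) := by
  ext x
  rcases x with ⟨i, x⟩ | _ | j
  · fin_cases x <;> simp
  · simp
  · simp

theorem buildable_U2 (m s : ℕ) : Buildable 3 (U2 m s).Adj univ (U2Label m s) := by
  rw [univ_U2]
  refine .iUnion _ (.unionJoins (.iUnion _ .empty (fun j => .singleton ?_ ?_) ?_ ?_ ?_ ?_)
    (.singleton ?_ ?_) ?_ [(0, 1)] ?_ ?_ ?_) (fun i => .edge ?_ rfl rfl) ?_ ?_ ?_ ?_
  all_goals first | (simp [U2, U2Label]; done) | simp +contextual [U2, eq_comm]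


theorem buildable_compl_U2 (m s : ℕ) : Buildable 3 (U2 m s)ᶜ.Adj univ (U2Label m s) := by
  rw [univ_U2]
  refine .iUnion_completeJoin _ (.union (.iUnion_completeJoin _ .empty (fun j => .singleton ?_ ?_)
    ?_ ?_ ?_ ?_ ?_ ?_) (.singleton ?_ ?_) ?_ ?_) (fun i => .nonEdge ?_ ?_ ?_ ?_) ?_ ?_ ?_ ?_ ?_ ?_
  all_goals first | (simp [U2, U2Label]; done) | simp +contextual [U2, eq_comm]


/-- The label `1` is used for the middle vertex of the path, the label `2` for the hub. -/
def U3Label (m : ℕ) : Option (Fin 3 ⊕ Fin m × Fin 2) → ℕ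
  | none => 2
  | some (.inl 1) => 1
  | _ => 0

theorem univ_U3 (m : ℕ) : (univ : Set (Option (Fin 3 ⊕ Fin m × Fin 2))) =
    (({some (.inl 0), some (.inl 2)} ∪ {some (.inl 1)}) ∪
      ⋃ i : Fin m, {some (.inr (i, 0)), some (.inr (i, 1))}) ∪ {none} := by
  ext x
  rcases x with _ | x | ⟨i, x⟩
  · simp
  · fin_cases x <;> simp
  · fin_cases x <;> simp

theorem buildable_U3 (m : ℕ) : Buildable 3 (U3 m).Adj univ (U3Label m) := by
  rw [univ_U3]
  refine .unionJoins (.iUnion _ (.unionJoins (.nonEdge ?_ ?_ ?_ ?_) (.singleton ?_ ?_) ?_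
    [(0, 1)] ?_ ?_ ?_) (fun i => .edge ?_ rfl rfl) ?_ ?_ ?_ ?_) (.singleton ?_ ?_) ?_
    [(0, 2)] ?_ ?_ ?_
  case refine_20 =>
    simp only [List.mem_singleton, forall_eq]
    rintro (_ | x | ⟨i, x⟩) _ (_ | y | ⟨j, y⟩) _
    all_goals try fin_cases x
    all_goals try fin_cases y
    all_goals simp [U3, U3Label]
  case refine_21 =>
    rintro (_ | x | ⟨i, x⟩)
    all_goals try fin_cases x
    all_goals simp [U3, U3Label]
  all_goals first | (simp [U3, U3Label]; done) | simp +contextual [U3, eq_comm]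


theorem buildable_compl_U3 (m : ℕ) : Buildable 3 (U3 m)ᶜ.Adj univ (U3Label m) := by
  rw [univ_U3]
  refine .unionJoins (.iUnion_completeJoin _ (.union (.edge ?_ rfl rfl) (.singleton ?_ ?_) ?_ ?_)
    (fun i => .nonEdge ?_ ?_ ?_ ?_) ?_ ?_ ?_ ?_ ?_ ?_) (.singleton ?_ ?_) ?_
    [(1, 2)] ?_ ?_ ?_
  case refine_20 =>
    simp only [List.mem_singleton, forall_eq]
    rintro (_ | x | ⟨i, x⟩) _ (_ | y | ⟨j, y⟩) _
    all_goals try fin_cases x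
    all_goals try fin_cases y
    all_goals simp [U3, U3Label]
  case refine_21 =>
    rintro (_ | x | ⟨i, x⟩)
    all_goals try fin_cases x
    all_goals simp [U3, U3Label]
  all_goals first | (simp [U3, U3Label]; done) | simp +contextual [U3, eq_comm]


end Buildable

theorem stmt9 {V : Type} [Fintype V] (G : SimpleGraph V)
    (h : (Nonempty (G ≃g SimpleGraph.cycleGraph 5) ∨
            Nonempty (Gᶜ ≃g SimpleGraph.cycleGraph 5)) ∨
         (∃ m : ℕ, 2 ≤ m ∧ (Nonempty (G ≃g mK2 m) ∨ Nonempty (Gᶜ ≃g mK2 m))) ∨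
         (∃ m s : ℕ, 1 ≤ m ∧ 2 ≤ s ∧
            (Nonempty (G ≃g U2 m s) ∨ Nonempty (Gᶜ ≃g U2 m s))) ∨
         (∃ m : ℕ, 1 ≤ m ∧ (Nonempty (G ≃g U3 m) ∨ Nonempty (Gᶜ ≃g U3 m)))) :
    cliqueWidth G ≤ 3 := by
  obtain (⟨⟨φ⟩⟩ | ⟨⟨φ⟩⟩) | ⟨m, -, ⟨⟨φ⟩⟩ | ⟨⟨φ⟩⟩⟩ | ⟨m, s, -, -, ⟨⟨φ⟩⟩ | ⟨⟨φ⟩⟩⟩ |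
    ⟨m, -, ⟨⟨φ⟩⟩ | ⟨⟨φ⟩⟩⟩ := h
  · exact buildable_cycleFive.cliqueWidth_le φ
  · exact buildable_cycleFive.cliqueWidth_le ((isoCompl φ).trans cycleFiveSelfCompl)
  · exact (buildable_mK2 m).cliqueWidth_le φ
  · exact (buildable_compl_mK2 m).cliqueWidth_le (isoCompl φ)
  · exact (buildable_U2 m s).cliqueWidth_le φ
  · exact (buildable_compl_U2 m s).cliqueWidth_le (isoCompl φ)
  · exact (buildable_U3 m).cliqueWidth_le φ
  · exact (buildable_compl_U3 m).cliqueWidth_le (isoCompl φ)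

end CWPaper
end

section
/- For all parameters p_1, q_1, …, p_t, q_t ≥ 1 with t ≥ 1 and q_1 + ⋯ + q_t ≥ 2, the split clique-width of S_2(p_1, q_1; …; p_t, q_t), regarded as a splitted graph with clique A equal to the set of star centers and independent set B equal to the set of star leaves, is at most 3. -/
namespace CWPaper

/-- Adjacency in the graph on centers `C` and leaves `L` in which the centers form a clique and
each leaf `e` is joined to its center `ctr e` only. -/
def starCliqueAdj {C L : Type*} (ctr : L → C) : C ⊕ L → C ⊕ L → Prop
  | .inl a, .inl b => a ≠ b
  | .inl c, .inr e => ctr e = c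
  | .inr e, .inl c => ctr e = c
  | .inr _, .inr _ => False

/-- Every nonempty finite edgeless graph, with all labels `1`, has a `3`-expression. -/
theorem exists_expr_independent {L : Type*} (T : Finset L) (hT : T.Nonempty) :
    ∃ (e : Expr) (f : e.Verts → L), e.Valid 3 ∧ Function.Injective f ∧ Set.range f = T ∧
      (∀ u v, ¬ e.adj u v) ∧ ∀ u, e.label u = 1 := by
  induction hT using Finset.Nonempty.cons_induction with
  | singleton a =>
    refine ⟨.vert 1, fun _ => a, by simp [Expr.Valid], fun _ _ _ => rfl, ?_, fun _ _ h => h,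
      fun _ => rfl⟩
    ext x
    simp only [Finset.coe_singleton, Set.mem_singleton_iff]
    exact ⟨fun ⟨_, h⟩ => h.symm, fun h => ⟨(), h.symm⟩⟩
  | cons a s ha hs ih =>
    obtain ⟨e, f, hv, hinj, hr, hadj, hl⟩ := ih
    have hf : ∀ u, f u ∈ s := fun u => by
      rw [← Finset.mem_coe, ← hr]; exact Set.mem_range_self u
    refine ⟨.union (.vert 1) e, Sum.elim (fun _ => a) f, ⟨by simp [Expr.Valid], hv⟩, ?_, ?_, ?_, ?_⟩
    · exact Function.Injective.sumElim (fun _ _ _ => rfl) hinj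
        fun _ u h => ha (h ▸ hf u)
    · ext x
      have hx : x ∈ Set.range f ↔ x ∈ s := by rw [hr]; rfl
      constructor
      · rintro ⟨u | u, rfl⟩
        · simp
        · simpa using Or.inr (hf u)
      · intro h
        rcases Finset.mem_cons.1 h with rfl | h
        · exact ⟨.inl (), rfl⟩
        · obtain ⟨u, rfl⟩ := hx.2 h
          exact ⟨.inr u, rfl⟩
    · rintro (u | u) (v | v) h
      · exact h
      · exact h
      · exact h
      · exact hadj u v h
    · rintro (u | u)
      · rfl
      · exact hl u

/-- A star has a `3`-expression labeling its center `2` and its leaves `1`. -/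
theorem exists_expr_star {C L : Type*} (ctr : L → C) (c : C) (T : Finset L)
    (hT : T.Nonempty) (hc : ∀ x, x ∈ T ↔ ctr x = c) :
    ∃ (e : Expr) (f : e.Verts → C ⊕ L), e.Valid 3 ∧ Function.Injective f ∧
      Set.range f = {x | Sum.elim id ctr x = c} ∧
      (∀ u v, e.adj u v ↔ starCliqueAdj ctr (f u) (f v)) ∧
      ∀ u, e.label u = Sum.elim (fun _ => 2) (fun _ => 1) (f u) := by
  obtain ⟨e, f, hv, hinj, hr, hadj, hl⟩ := exists_expr_independent T hT
  have hf : ∀ u, ctr (f u) = c := fun u => by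
    rw [← hc, ← Finset.mem_coe, ← hr]; exact Set.mem_range_self u
  refine ⟨.join 2 1 (.union (.vert 2) e), Sum.elim (fun _ => .inl c) (fun u => .inr (f u)),
    ⟨by simp, by simp, by simp, by simp [Expr.Valid], hv⟩, ?_, ?_, ?_, ?_⟩
  · exact Function.Injective.sumElim (fun _ _ _ => rfl) (Sum.inr_injective.comp hinj)
      fun _ u h => by cases h
  · ext x
    constructor
    · rintro ⟨u | u, rfl⟩
      · rfl
      · exact hf u
    · rcases x with x | x
      · rintro rfl
        exact ⟨.inl (), rfl⟩
      · intro h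
        have : x ∈ Set.range f := by rw [hr]; exact (hc x).2 h
        obtain ⟨u, rfl⟩ := this
        exact ⟨.inr u, rfl⟩
  · rintro (u | u) (v | v)
    · simp [Expr.adj, Expr.label, starCliqueAdj]
    · simp [Expr.adj, Expr.label, starCliqueAdj, hl, hf]
    · simp [Expr.adj, Expr.label, starCliqueAdj, hl, hf]
    · simp [Expr.adj, Expr.label, starCliqueAdj, hl, hadj]
  · rintro (u | u)
    · rfl
    · exact hl u

/-- The subgraph formed by the stars around a nonempty finite set of centers has a
`3`-expression labeling the centers `0` and the leaves `1`. -/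
theorem exists_expr_starClique {C L : Type*} [Fintype L] (ctr : L → C)
    (hctr : Function.Surjective ctr) (S : Finset C) (hS : S.Nonempty) :
    ∃ (e : Expr) (f : e.Verts → C ⊕ L), e.Valid 3 ∧ Function.Injective f ∧
      Set.range f = {x | Sum.elim id ctr x ∈ S} ∧
      (∀ u v, e.adj u v ↔ starCliqueAdj ctr (f u) (f v)) ∧
      ∀ u, e.label u = Sum.elim (fun _ => 0) (fun _ => 1) (f u) := by
  classical
  have star (c : C) := exists_expr_star ctr c (Finset.univ.filter fun x => ctr x = c)
    (by obtain ⟨x, hx⟩ := hctr c; exact ⟨x, by simpa using hx⟩) (by simp)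
  induction hS using Finset.Nonempty.cons_induction with
  | singleton c =>
    obtain ⟨e, f, hv, hinj, hr, hadj, hl⟩ := star c
    refine ⟨.relabel 2 0 e, f, ⟨by simp, by simp, hv⟩, hinj, ?_, hadj, ?_⟩
    · refine hr.trans ?_
      ext x
      simp
    · intro (u : e.Verts)
      simp only [Expr.label, hl]
      cases f u <;> simp
  | cons c s hc hs ih =>
    obtain ⟨e, f, hv, hinj, hr, hadj, hl⟩ := star c
    obtain ⟨e', f', hv', hinj', hr', hadj', hl'⟩ := ih
    have hf : ∀ u, Sum.elim id ctr (f u) = c := fun u => by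
      have := Set.mem_range_self (f := f) u; rwa [hr] at this
    have hf' : ∀ u, Sum.elim id ctr (f' u) ∈ s := fun u => by
      have := Set.mem_range_self (f := f') u; rwa [hr'] at this
    have hne : ∀ u v, Sum.elim id ctr (f u) ≠ Sum.elim id ctr (f' v) := fun u v h =>
      hc (by rw [← hf u, h]; exact hf' v)
    refine ⟨.relabel 2 0 (.join 2 0 (.union e e')), Sum.elim f f',
      ⟨by simp, by simp, by simp, by simp, by simp, hv, hv'⟩, ?_, ?_, ?_, ?_⟩
    · exact hinj.sumElim hinj' fun u v h => hne u v (by rw [h])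
    · refine (Set.Sum.elim_range f f').trans ?_
      rw [hr, hr']
      ext x
      simp
    · rintro (u | u) (v | v)
      · simp only [Expr.adj, Expr.label, Sum.elim_inl, hl, hadj]
        cases f u <;> cases f v <;> simp
      · have := hne u v
        simp only [Expr.adj, Expr.label, Sum.elim_inl, Sum.elim_inr, hl, hl']
        revert this
        cases f u <;> cases f' v <;> simp [starCliqueAdj, eq_comm]
      · have := hne v u
        simp only [Expr.adj, Expr.label, Sum.elim_inl, Sum.elim_inr, hl, hl']
        revert this
        cases f v <;> cases f' u <;> simp [starCliqueAdj, eq_comm]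
      · simp only [Expr.adj, Expr.label, Sum.elim_inr, hl', hadj']
        cases f' u <;> cases f' v <;> simp
    · rintro (u | u)
      · simp only [Expr.label, Sum.elim_inl, hl]
        cases f u <;> simp
      · simp only [Expr.label, Sum.elim_inr, hl']
        cases f' u <;> simp

theorem S2_adj_iff {t : ℕ} {p q : Fin t → ℕ} (x y : S2Verts t p q) :
    (S2 t p q).Adj x y ↔ starCliqueAdj leafCenter x y := by
  refine (SimpleGraph.fromRel_adj _ _ _).trans ?_
  rcases x with x | x <;> rcases y with y | y
  · exact ⟨fun h => Sum.inl_injective.ne_iff.1 h.1,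
      fun h => ⟨Sum.inl_injective.ne_iff.2 h, Or.inl trivial⟩⟩
  · exact ⟨fun h => h.2.elim id False.elim, fun h => ⟨Sum.inl_ne_inr, Or.inl h⟩⟩
  · exact ⟨fun h => h.2.elim False.elim id, fun h => ⟨Sum.inr_ne_inl, Or.inr h⟩⟩
  · exact ⟨fun h => h.2.elim id id, False.elim⟩

theorem stmt13 (t : ℕ) (ht : 1 ≤ t) (p q : Fin t → ℕ)
    (hp : ∀ i, 1 ≤ p i) (hq : ∀ i, 1 ≤ q i) (hsum : 2 ≤ ∑ i, q i) :
    splitCliqueWidth (S2 t p q) (Set.range Sum.inl) (Set.range Sum.inr) ≤ 3 := by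
  have hsurj : Function.Surjective (leafCenter (p := p) (q := q)) := fun ⟨i, j⟩ =>
    ⟨⟨i, j, ⟨0, hp i⟩⟩, rfl⟩
  obtain ⟨e, f, hv, hinj, hr, hadj, hl⟩ := exists_expr_starClique leafCenter hsurj
    (Finset.univ : Finset (Σ i : Fin t, Fin (q i)))
    ⟨⟨⟨0, ht⟩, ⟨0, hq _⟩⟩, Finset.mem_univ _⟩
  have hf : Function.Surjective f := Set.range_eq_univ.1 (by simp [hr])
  refine Nat.sInf_le ⟨e, hv, Equiv.ofBijective f ⟨hinj, hf⟩, fun u v => ?_, fun u => ⟨?_, ?_⟩⟩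
  · exact (S2_adj_iff _ _).trans (hadj u v).symm
  · rintro ⟨c, hc⟩
    have h : f u = Sum.inl c := hc.symm
    rw [hl, h]
    rfl
  · rintro ⟨x, hx⟩
    have h : f u = Sum.inr x := hx.symm
    rw [hl, h]
    rfl


end CWPaper
end
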